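/- Let d be a positive integer with d ≡ 0 or 3 (mod 4), and let M be an odd squarefree positive integer such that every prime p dividing M satisfies p ∤ d and −d is not a square modulo p (i.e. p is inert in ℚ(√−d)). For each such prime p, let R_p = ℤ_p + ℤ_p·√−d (the valuation ring of ℚ_p(√−d)), and let Γ⁰_{L,p} = {x + y√−d ∈ R_p^× : x, y ∈ ℤ_p, p | y}, a subgroup of R_p^×; the quotient group R_p^×/Γ⁰_{L,p} is cyclic of order p+1. Then there exists an integer b such that 4 divides b² + d and, for every prime p dividing M, the class of (−b + √−d)/2 generates the group R_p^×/Γ⁰_{L,p}. -/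

import Mathlib

open Matrix

noncomputable section

/-- The element `x + y·√−d` of `R_p = ℤ_p + ℤ_p√−d`, realized concretely as the
2×2 matrix `(x, −d·y; y, x)` over `ℚ_p` (multiplication of such matrices agrees
with multiplication in `ℚ_p(√−d)`). -/
def qmat (p : ℕ) [Fact p.Prime] (d : ℕ) (x y : ℚ_[p]) : Matrix (Fin 2) (Fin 2) ℚ_[p] :=
  !![x, -(d : ℚ_[p]) * y; y, x]

/-- The valuation ring `R_p = ℤ_p + ℤ_p√−d` of `ℚ_p(√−d)`. -/
def Rring (p : ℕ) [Fact p.Prime] (d : ℕ) : Set (Matrix (Fin 2) (Fin 2) ℚ_[p]) :=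
  {g | ∃ x y : ℚ_[p], ‖x‖ ≤ 1 ∧ ‖y‖ ≤ 1 ∧ g = qmat p d x y}

/-- The unit group `R_p^×`: elements `x + y√−d` with `x, y ∈ ℤ_p` not both
divisible by `p`. -/
def Runits (p : ℕ) [Fact p.Prime] (d : ℕ) : Set (Matrix (Fin 2) (Fin 2) ℚ_[p]) :=
  {g | ∃ x y : ℚ_[p], ‖x‖ ≤ 1 ∧ ‖y‖ ≤ 1 ∧ (‖x‖ = 1 ∨ ‖y‖ = 1) ∧ g = qmat p d x y}

/-- The subgroup `Γ⁰_{L,p}` of `R_p^×`: units `x + y√−d` with `p ∣ y`. -/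
def Gamma0L (p : ℕ) [Fact p.Prime] (d : ℕ) : Set (Matrix (Fin 2) (Fin 2) ℚ_[p]) :=
  {g | ∃ x y : ℚ_[p], ‖x‖ = 1 ∧ ‖y‖ < 1 ∧ ‖y‖ ≤ 1 ∧ g = qmat p d x y}

/-- The ring homomorphism of quadratic algebras induced by a ring homomorphism on coefficients. -/
def QuadraticAlgebra.mapRingHom {S T : Type*} [CommRing S] [CommRing T] {a b : S} {a' b' : T}
    (f : S →+* T) (ha : f a = a') (hb : f b = b') :
    QuadraticAlgebra S a b →+* QuadraticAlgebra T a' b' where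
  toFun z := ⟨f z.re, f z.im⟩
  map_one' := by ext <;> simp
  map_mul' z w := by ext <;> simp [ha, hb]
  map_zero' := by ext <;> simp
  map_add' z w := by ext <;> simp

/-- The matrix realization `x + y·√−d ↦ qmat p d x y` on `ℤ_p[√−d]`, as a monoid homomorphism. -/
def qmatHom (p : ℕ) [Fact p.Prime] (d : ℕ) :
    QuadraticAlgebra ℤ_[p] (-(d : ℤ_[p])) 0 →* Matrix (Fin 2) (Fin 2) ℚ_[p] where
  toFun z := qmat p d z.re z.im
  map_one' := by
    ext i j
    fin_cases i <;> fin_cases j <;> simp [qmat, QuadraticAlgebra.re_one, QuadraticAlgebra.im_one]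
  map_mul' z w := by
    ext i j
    fin_cases i <;> fin_cases j <;>
      simp [qmat, Matrix.mul_apply, Fin.sum_univ_two] <;> ring

/-- In a finite quadratic field extension `K(√a)`, some `c + √a` generates the multiplicative group
modulo `Kˣ`; so does any nonzero multiple of it. -/
theorem QuadraticAlgebra.exists_generator_mod_base {K : Type*} [Field K] [Finite K] {a : K}
    (ha : ¬ ∃ x : K, x ^ 2 = a) :
    ∃ c : K, ∀ s : K, s ≠ 0 → ∀ z : QuadraticAlgebra K a 0, z ≠ 0 →
      ∃ (n : ℕ) (r : K), r ≠ 0 ∧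
        z = (⟨s * c, s⟩ : QuadraticAlgebra K a 0) ^ n * algebraMap K _ r := by
  have : Fact (∀ r : K, r ^ 2 ≠ a + 0 * r) := ⟨fun r hr => ha ⟨r, by simpa using hr⟩⟩
  have : Finite (QuadraticAlgebra K a 0) := Module.finite_of_finite K
  obtain ⟨α, hα⟩ := IsCyclic.exists_monoid_generator (α := (QuadraticAlgebra K a 0)ˣ)
  have gen (z : QuadraticAlgebra K a 0) (hz : z ≠ 0) :
      ∃ n : ℕ, z = (α : QuadraticAlgebra K a 0) ^ n := by
    obtain ⟨n, hn⟩ := Submonoid.mem_powers_iff _ _ |>.1 (hα (Units.mk0 z hz))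
    exact ⟨n, by simpa using (congrArg Units.val hn).symm⟩
  obtain ⟨⟨x, y⟩, hxy⟩ : ∃ β : QuadraticAlgebra K a 0, β = α := ⟨_, rfl⟩
  have hy : y ≠ 0 := by
    rintro rfl
    obtain ⟨n, hn⟩ := gen ⟨0, 1⟩ (fun h => one_ne_zero (congrArg QuadraticAlgebra.im h))
    rw [← hxy, show (⟨x, 0⟩ : QuadraticAlgebra K a 0) = algebraMap K _ x from rfl,
      ← map_pow] at hn
    exact one_ne_zero (congrArg QuadraticAlgebra.im hn)
  refine ⟨x / y, fun s hs z hz => ?_⟩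
  obtain ⟨n, rfl⟩ := gen z hz
  refine ⟨n, (y / s) ^ n, pow_ne_zero _ (div_ne_zero hy hs), ?_⟩
  rw [map_pow, ← mul_pow, ← hxy]
  congr 1
  ext <;> simp <;> field_simp

theorem PadicInt.toZMod_eq_zero_iff_norm_lt_one {p : ℕ} [Fact p.Prime] (x : ℤ_[p]) :
    PadicInt.toZMod x = 0 ↔ ‖x‖ < 1 := by
  rw [← RingHom.mem_ker, PadicInt.ker_toZMod, IsLocalRing.mem_maximalIdeal, PadicInt.mem_nonunits]

theorem PadicInt.toZMod_ne_zero_iff_isUnit {p : ℕ} [Fact p.Prime] (x : ℤ_[p]) :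
    PadicInt.toZMod x ≠ 0 ↔ IsUnit x := by
  rw [Ne, toZMod_eq_zero_iff_norm_lt_one, ← PadicInt.not_isUnit_iff, not_not]

/-- If the reduction of `s * (c + √−d)` generates the units of `𝔽_p(√−d)` modulo `𝔽_pˣ`, then
`s * (c + √−d)` generates `R_pˣ` modulo `Γ⁰_{L,p}`. -/
theorem exists_eq_qmat_pow_mul_of_reduction {p d : ℕ} [Fact p.Prime]
    (hd : ¬ ∃ x : ZMod p, x ^ 2 = -(d : ZMod p)) {x y : ℤ_[p]} (hy : PadicInt.toZMod y ≠ 0)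
    (hgen : ∀ z : QuadraticAlgebra (ZMod p) (-(d : ZMod p)) 0, z ≠ 0 →
      ∃ (n : ℕ) (r : ZMod p), r ≠ 0 ∧
        z = (⟨PadicInt.toZMod x, PadicInt.toZMod y⟩ : QuadraticAlgebra (ZMod p) (-(d : ZMod p)) 0)
          ^ n * algebraMap (ZMod p) _ r)
    {u : Matrix (Fin 2) (Fin 2) ℚ_[p]} (hu : u ∈ Runits p d) :
    ∃ n : ℕ, ∃ g ∈ Gamma0L p d, u = qmat p d x y ^ n * g := by
  have : Fact (∀ r : ZMod p, r ^ 2 ≠ -(d : ZMod p) + 0 * r) :=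
    ⟨fun r hr => hd ⟨r, by simpa using hr⟩⟩
  let red : QuadraticAlgebra ℤ_[p] (-(d : ℤ_[p])) 0 →+*
      QuadraticAlgebra (ZMod p) (-(d : ZMod p)) 0 :=
    QuadraticAlgebra.mapRingHom PadicInt.toZMod (by simp) (by simp)
  obtain ⟨v, w, hv, hw, hvw, rfl⟩ := hu
  obtain ⟨v, rfl⟩ : ∃ v' : ℤ_[p], (v' : ℚ_[p]) = v := ⟨⟨v, hv⟩, rfl⟩
  obtain ⟨w, rfl⟩ : ∃ w' : ℤ_[p], (w' : ℚ_[p]) = w := ⟨⟨w, hw⟩, rfl⟩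
  let β : QuadraticAlgebra ℤ_[p] (-(d : ℤ_[p])) 0 := ⟨x, y⟩
  have hβ : IsUnit β := by
    rw [QuadraticAlgebra.isUnit_iff_norm_isUnit, ← PadicInt.toZMod_ne_zero_iff_isUnit]
    have h : PadicInt.toZMod β.norm = (red β).norm := by
      simp [QuadraticAlgebra.norm_def, red, QuadraticAlgebra.mapRingHom]
    rw [h, Ne, QuadraticAlgebra.norm_eq_zero_iff_eq_zero]
    exact fun h => hy (congrArg QuadraticAlgebra.im h)
  have hz : red ⟨v, w⟩ ≠ 0 := by
    intro h
    have h1 := (PadicInt.toZMod_eq_zero_iff_norm_lt_one v).1 (congrArg QuadraticAlgebra.re h)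
    have h2 := (PadicInt.toZMod_eq_zero_iff_norm_lt_one w).1 (congrArg QuadraticAlgebra.im h)
    rw [PadicInt.norm_def] at h1 h2
    rcases hvw with hvw | hvw
    · exact h1.ne hvw
    · exact h2.ne hvw
  obtain ⟨n, r, hr, hn⟩ := hgen _ hz
  obtain ⟨g, hg⟩ := (hβ.pow n).dvd (a := ⟨v, w⟩)
  have hredg : red g = algebraMap (ZMod p) _ r := by
    refine ((hβ.pow n).map red).mul_left_cancel ?_
    rw [← map_mul, ← hg, hn, map_pow]
    rfl
  have hre : PadicInt.toZMod g.re = r := congrArg QuadraticAlgebra.re hredg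
  have him : PadicInt.toZMod g.im = 0 := congrArg QuadraticAlgebra.im hredg
  refine ⟨n, qmatHom p d g, ⟨g.re, g.im, ?_, ?_, PadicInt.norm_le_one _, rfl⟩, ?_⟩
  · exact PadicInt.isUnit_iff.1 ((PadicInt.toZMod_ne_zero_iff_isUnit _).1 (hre ▸ hr))
  · exact (PadicInt.toZMod_eq_zero_iff_norm_lt_one _).1 him
  · have h := congrArg (qmatHom p d) hg
    rwa [map_mul, map_pow] at h

/-- There is an integer `b` with `4 ∣ b² + d` such that, for every prime `p ∣ M`,
the class of `(−b + √−d)/2` generates the quotient group `R_p^× / Γ⁰_{L,p}`, i.e.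
every unit is of the form `((−b + √−d)/2)ⁿ · g` with `g ∈ Γ⁰_{L,p}`. -/
theorem exists_generator_of_unit_quotients (d M : ℕ)
    (hd0 : 0 < d) (hd4 : d % 4 = 0 ∨ d % 4 = 3)
    (hM0 : 0 < M) (hModd : Odd M) (hMsf : Squarefree M)
    (hinert : ∀ q : ℕ, q.Prime → q ∣ M →
      ¬ (q ∣ d) ∧ ¬ ∃ x : ZMod q, x ^ 2 = -(d : ZMod q)) :
    ∃ b : ℤ, (4 : ℤ) ∣ b ^ 2 + (d : ℤ) ∧
      ∀ (q : ℕ) [Fact q.Prime], q ∣ M →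
        ∀ u ∈ Runits q d, ∃ n : ℕ, ∃ g ∈ Gamma0L q d,
          u = (qmat q d (-(b : ℚ_[q]) / 2) (1 / 2)) ^ n * g := by
  classical
  have hc (q : ℕ) : ∃ k : ℕ, ∀ [Fact q.Prime], q ∣ M → ∀ s : ZMod q, s ≠ 0 →
      ∀ z : QuadraticAlgebra (ZMod q) (-(d : ZMod q)) 0, z ≠ 0 → ∃ (n : ℕ) (r : ZMod q), r ≠ 0 ∧
        z = (⟨s * -(k : ZMod q), s⟩ : QuadraticAlgebra (ZMod q) (-(d : ZMod q)) 0) ^ n *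
          algebraMap (ZMod q) _ r := by
    by_cases hq : q.Prime ∧ q ∣ M
    · have : Fact q.Prime := ⟨hq.1⟩
      obtain ⟨c, hc⟩ := QuadraticAlgebra.exists_generator_mod_base (hinert q hq.1 hq.2).2
      refine ⟨(-c).val, fun _ => ?_⟩
      simpa using hc
    · exact ⟨0, fun {h} h' => absurd ⟨h.out, h'⟩ hq⟩
  choose k hk using hc
  obtain ⟨K, hK⟩ := Nat.chineseRemainderOfFinset k id M.primeFactors
    (fun q hq => (Nat.prime_of_mem_primeFactors hq).ne_zero)
    (fun q hq q' hq' h => (Nat.coprime_primes (Nat.prime_of_mem_primeFactors hq)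
      (Nat.prime_of_mem_primeFactors hq')).2 h)
  refine ⟨K + M * (K + d), ?_, fun q _ hqM u hu => ?_⟩
  · obtain ⟨m, rfl⟩ := hModd
    have hdd : (4 : ℤ) ∣ d * (d + 1) := by
      rcases hd4 with h | h
      · exact Dvd.dvd.mul_right (by omega) _
      · exact Dvd.dvd.mul_left (by omega) _
    obtain ⟨e, he⟩ := hdd
    refine ⟨(K + m * (K + d)) ^ 2 + (K + m * (K + d)) * d + e, ?_⟩
    push_cast
    linear_combination he
  · have hq2 : q ≠ 2 := by
      rintro rfl
      exact (Nat.not_even_iff_odd.2 hModd) (even_iff_two_dvd.2 hqM)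
    have h2 : PadicInt.toZMod (2 : ℤ_[q]) ≠ 0 := by
      rw [map_ofNat]
      exact Ring.two_ne_zero (by rwa [ZMod.ringChar_zmod_n])
    obtain ⟨t, ht⟩ : ∃ t : ℤ_[q], 2 * t = 1 :=
      ((PadicInt.toZMod_ne_zero_iff_isUnit (2 : ℤ_[q])).1 h2).exists_right_inv
    have htQ : (t : ℚ_[q]) = 1 / 2 := by
      have h : (2 : ℚ_[q]) * t = 1 := by exact_mod_cast congrArg (Subtype.val) ht
      linear_combination h / 2
    have ht0 : PadicInt.toZMod t ≠ 0 := by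
      intro h
      simpa [h] using congrArg PadicInt.toZMod ht
    have hKq : (K : ZMod q) = k q :=
      (ZMod.natCast_eq_natCast_iff _ _ _).2
        (hK q (Nat.mem_primeFactors.2 ⟨Fact.out, hqM, hM0.ne'⟩))
    have hMq : (M : ZMod q) = 0 := (ZMod.natCast_eq_zero_iff _ _).2 hqM
    have hx : PadicInt.toZMod (t * -(K + M * (K + d) : ℤ_[q])) =
        PadicInt.toZMod t * -(k q : ZMod q) := by
      simp [hKq, hMq]
    obtain ⟨n, g, hg, h⟩ := exists_eq_qmat_pow_mul_of_reduction
      (hinert q Fact.out hqM).2 (x := t * -(K + M * (K + d) : ℤ_[q])) ht0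
      (by rw [hx]; exact hk q hqM _ ht0) hu
    refine ⟨n, g, hg, ?_⟩
    rw [h]
    congr 3
    push_cast
    rw [htQ]
    ring
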